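/- Assume λ = hv with deg h ≥ 1. Let {s_1, …, s_m} = {i ∈ {0, …, n−1} : (x − α_i) |_r v} and let {l_1, …, l_r} = {0, …, n−1} \ {s_1, …, s_m}. For 1 ≤ i ≤ r define f_i = lclm(f_{i−1}, x − α_{l_i}) with f_0 = v. Then: (1) there exists d ≥ 1 with deg f_{d−1} = deg f_d; (2) if d_0 is the minimal such index, then x − α_{l_{d_0}} right-divides λ, i.e. l_{d_0} ∈ {k_1, …, k_ν} is an error position. -/

import Mathlib

/-- `δ` is a `σ`-derivation of the field `L`. -/
def IsSigmaDerivation {L : Type*} [Field L] (σ : L ≃+* L) (δ : L → L) : Prop :=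
  (∀ a b : L, δ (a + b) = δ a + δ b) ∧ ∀ a b : L, δ (a * b) = σ a * δ b + δ a * b

/-- The ring `R`, together with the embedding of constants `C : L →+* R` and the
element `X`, is the Ore extension `L[x;σ,δ]`: the twisting rule
`X * C a = C (σ a) * X + C (δ a)` holds and every element of `R` is, in a unique way,
a left `L`-linear combination of the powers of `X`. -/
structure IsOreExtension {L : Type*} [Field L] (σ : L ≃+* L) (δ : L → L)
    (R : Type*) [Ring R] (C : L →+* R) (X : R) : Prop where
  twist : ∀ a : L, X * C a = C (σ a) * X + C (δ a)
  repr_unique : ∀ r : R, ∃! f : ℕ →₀ L, r = f.sum fun n a => C a * X ^ n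

/-- The degree of an Ore polynomial (`⊥` for the zero polynomial). -/
noncomputable def IsOreExtension.deg {L : Type*} [Field L] {σ : L ≃+* L} {δ : L → L}
    {R : Type*} [Ring R] {C : L →+* R} {X : R}
    (H : IsOreExtension σ δ R C X) (r : R) : WithBot ℕ :=
  (H.repr_unique r).exists.choose.support.max

/-- `f` is a right divisor of `g` : `g = u * f` for some `u`. -/
def RDvd {R : Type*} [Ring R] (f g : R) : Prop := ∃ u, g = u * f

/-- `f` is a left divisor of `g` : `g = f * u` for some `u`. -/
def LDvd {R : Type*} [Ring R] (f g : R) : Prop := ∃ u, g = f * u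

/-- `m` is a least common left multiple of the family `f`. -/
def IsLclm {R : Type*} [Ring R] {ι : Type*} (f : ι → R) (m : R) : Prop :=
  (∀ i, RDvd (f i) m) ∧ ∀ m' : R, (∀ i, RDvd (f i) m') → RDvd m m'

/-- `m` is a least common right multiple of the family `f`. -/
def IsLcrm {R : Type*} [Ring R] {ι : Type*} (f : ι → R) (m : R) : Prop :=
  (∀ i, LDvd (f i) m) ∧ ∀ m' : R, (∀ i, LDvd (f i) m') → LDvd m m'

/-- `gcld (f, g) = 1`, i.e. `fR + gR = R`. -/
def LCoprime {R : Type*} [Ring R] (f g : R) : Prop := ∃ a b : R, f * a + g * b = 1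

/-- `gcrd (f, g) = 1`, i.e. `Rf + Rg = R`. -/
def RCoprime {R : Type*} [Ring R] (f g : R) : Prop := ∃ a b : R, a * f + b * g = 1

namespace IsOreExtension

variable {L : Type*} [Field L] {σ : L ≃+* L} {δ : L → L}
  {R : Type*} [Ring R] {C : L →+* R} {X : R}

theorem deg_sum (H : IsOreExtension σ δ R C X) (f : ℕ →₀ L) :
    H.deg (f.sum fun n a => C a * X ^ n) = f.support.max := by
  unfold IsOreExtension.deg
  have h := (H.repr_unique (f.sum fun n a => C a * X ^ n)).exists.choose_spec
  rw [(H.repr_unique (f.sum fun n a => C a * X ^ n)).unique h rfl]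

/-- The additive subgroup of Ore polynomials of degree less than `n`. -/
def degLT (H : IsOreExtension σ δ R C X) (n : ℕ) : AddSubgroup R where
  carrier := {r | H.deg r < n}
  zero_mem' := by
    have h := H.deg_sum 0
    simp only [Finsupp.sum_zero_index, Finsupp.support_zero, Finset.max_empty] at h
    simp [h]
  add_mem' := by
    intro a b ha hb
    obtain ⟨f, rfl⟩ := (H.repr_unique a).exists
    obtain ⟨g, rfl⟩ := (H.repr_unique b).exists
    simp only [Set.mem_ofPred_eq] at *
    rw [← Finsupp.sum_add_index' (by simp) (by simp [add_mul]), deg_sum]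
    rw [deg_sum] at ha hb
    refine (Finset.max_mono Finsupp.support_add).trans_lt ?_
    rw [Finset.max_union]
    exact max_lt ha hb
  neg_mem' := by
    intro a ha
    obtain ⟨f, rfl⟩ := (H.repr_unique a).exists
    simp only [Set.mem_ofPred_eq] at *
    have h : -(f.sum fun n a => C a * X ^ n) = (-f).sum fun n a => C a * X ^ n := by
      rw [Finsupp.sum_neg_index (by simp)]
      simp [Finsupp.sum]
    rw [deg_sum] at ha
    rwa [h, deg_sum, Finsupp.support_neg]

theorem mem_degLT (H : IsOreExtension σ δ R C X) {n : ℕ} {r : R} :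
    r ∈ H.degLT n ↔ H.deg r < n := Iff.rfl

theorem degLT_mono (H : IsOreExtension σ δ R C X) {m n : ℕ} (h : m ≤ n) {r : R}
    (hr : r ∈ H.degLT m) : r ∈ H.degLT n :=
  lt_of_lt_of_le (H.mem_degLT.1 hr) (by exact_mod_cast h)

theorem deg_monomial (H : IsOreExtension σ δ R C X) {a : L} (ha : a ≠ 0) (n : ℕ) :
    H.deg (C a * X ^ n) = n := by
  have h := H.deg_sum (Finsupp.single n a)
  rw [Finsupp.sum_single_index (by simp), Finsupp.support_single _ ha,
    Finset.max_singleton] at h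
  exact h

theorem monomial_mem_degLT (H : IsOreExtension σ δ R C X) (a : L) {m n : ℕ} (h : m < n) :
    C a * X ^ m ∈ H.degLT n := by
  by_cases ha : a = 0
  · simp [ha]
  · rw [mem_degLT, H.deg_monomial ha]
    exact_mod_cast h

/-- Induction principle for polynomials of degree less than `n`. -/
theorem degLT_le (H : IsOreExtension σ δ R C X) {n : ℕ} {S : AddSubgroup R}
    (hS : ∀ (a : L) (m : ℕ), m < n → C a * X ^ m ∈ S) : H.degLT n ≤ S := by
  intro r hr
  obtain ⟨f, rfl⟩ := (H.repr_unique r).exists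
  rw [mem_degLT, deg_sum] at hr
  refine S.sum_mem fun m hm => hS _ _ ?_
  exact WithBot.coe_lt_coe.1 ((Finset.le_max hm).trans_lt hr)

theorem C_mul_mem_degLT (H : IsOreExtension σ δ R C X) (a : L) {n : ℕ} {r : R}
    (hr : r ∈ H.degLT n) : C a * r ∈ H.degLT n := by
  have h : H.degLT n ≤ (H.degLT n).comap (AddMonoidHom.mulLeft (C a)) := by
    refine H.degLT_le fun b m hm => ?_
    simpa [← mul_assoc, ← map_mul] using H.monomial_mem_degLT (a * b) hm
  exact h hr

theorem X_mul_mem_degLT (H : IsOreExtension σ δ R C X) {n : ℕ} {r : R}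
    (hr : r ∈ H.degLT n) : X * r ∈ H.degLT (n + 1) := by
  have h : H.degLT n ≤ (H.degLT (n + 1)).comap (AddMonoidHom.mulLeft X) := by
    refine H.degLT_le fun b m hm => ?_
    have e : X * (C b * X ^ m) = C (σ b) * X ^ (m + 1) + C (δ b) * X ^ m := by
      rw [← mul_assoc, H.twist, add_mul, mul_assoc, ← pow_succ']
    simp only [AddSubgroup.mem_comap, AddMonoidHom.coe_mulLeft, e]
    exact add_mem (H.monomial_mem_degLT _ (by omega)) (H.monomial_mem_degLT _ (by omega))
  exact h hr

theorem X_pow_mul_mem_degLT (H : IsOreExtension σ δ R C X) (m : ℕ) {n : ℕ} {r : R}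
    (hr : r ∈ H.degLT n) : X ^ m * r ∈ H.degLT (m + n) := by
  induction m with
  | zero => simpa using hr
  | succ m ih =>
    rw [pow_succ', mul_assoc]
    exact H.degLT_mono (by omega) (H.X_mul_mem_degLT ih)

theorem mul_mem_degLT (H : IsOreExtension σ δ R C X) {m n : ℕ} {p q : R}
    (hp : p ∈ H.degLT m) (hq : q ∈ H.degLT (n + 1)) : p * q ∈ H.degLT (m + n) := by
  have h : H.degLT m ≤ (H.degLT (m + n)).comap (AddMonoidHom.mulRight q) := by
    refine H.degLT_le fun b i hi => ?_
    simp only [AddSubgroup.mem_comap, AddMonoidHom.coe_mulRight, mul_assoc]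
    exact H.C_mul_mem_degLT _ (H.degLT_mono (by omega) (H.X_pow_mul_mem_degLT i hq))
  exact h hp

theorem X_pow_mul_monomial (H : IsOreExtension σ δ R C X) (m n : ℕ) {b : L} (hb : b ≠ 0) :
    ∃ c : L, c ≠ 0 ∧ X ^ m * (C b * X ^ n) - C c * X ^ (m + n) ∈ H.degLT (m + n) := by
  induction m with
  | zero => exact ⟨b, hb, by simp⟩
  | succ m ih =>
    obtain ⟨c, hc, h⟩ := ih
    refine ⟨σ c, by simpa using hc, ?_⟩
    have e : X ^ (m + 1) * (C b * X ^ n) - C (σ c) * X ^ (m + 1 + n)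
        = X * (X ^ m * (C b * X ^ n) - C c * X ^ (m + n)) + C (δ c) * X ^ (m + n) := by
      have t : X * (C c * X ^ (m + n)) = C (σ c) * X ^ (m + 1 + n) + C (δ c) * X ^ (m + n) := by
        rw [← mul_assoc, H.twist, add_mul, mul_assoc, ← pow_succ']
        congr 3; omega
      rw [mul_sub, t, pow_succ', mul_assoc]
      abel
    rw [e]
    exact add_mem (H.degLT_mono (by omega) (H.X_mul_mem_degLT h))
      (H.monomial_mem_degLT _ (by omega))

theorem exists_leading (H : IsOreExtension σ δ R C X) {r : R} {n : ℕ} (hr : H.deg r = n) :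
    ∃ a : L, a ≠ 0 ∧ r - C a * X ^ n ∈ H.degLT n := by
  obtain ⟨f, rfl⟩ := (H.repr_unique r).exists
  rw [deg_sum] at hr
  have hn : n ∈ f.support := Finset.mem_of_max hr
  refine ⟨f n, by simpa using hn, ?_⟩
  rw [Finsupp.sum, ← Finset.add_sum_erase _ _ hn, add_sub_cancel_left]
  refine AddSubgroup.sum_mem _ fun i hi => H.monomial_mem_degLT _ ?_
  rw [Finset.mem_erase] at hi
  have := Finset.le_max hi.2
  rw [hr] at this
  exact lt_of_le_of_ne (WithBot.coe_le_coe.1 this) hi.1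

theorem deg_eq_of_leading (H : IsOreExtension σ δ R C X) {r : R} {n : ℕ} {a : L} (ha : a ≠ 0)
    (hr : r - C a * X ^ n ∈ H.degLT n) : H.deg r = n := by
  apply le_antisymm
  · have h : r ∈ H.degLT (n + 1) := by
      have := add_mem (H.degLT_mono n.le_succ hr) (H.monomial_mem_degLT a n.lt_succ_self)
      simpa using this
    rw [mem_degLT] at h
    by_cases hd : H.deg r = ⊥
    · simp [hd]
    obtain ⟨d, hd⟩ := WithBot.ne_bot_iff_exists.1 hd
    rw [← hd] at h ⊢
    exact WithBot.coe_le_coe.2 (Nat.lt_succ_iff.1 (WithBot.coe_lt_coe.1 h))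
  · by_contra! h
    have := sub_mem (H.mem_degLT.2 h) hr
    rw [sub_sub_cancel, mem_degLT, H.deg_monomial ha] at this
    exact lt_irrefl _ this

theorem deg_zero (H : IsOreExtension σ δ R C X) : H.deg 0 = ⊥ := by
  have h := H.deg_sum 0
  simpa using h

theorem deg_eq_bot (H : IsOreExtension σ δ R C X) {r : R} : H.deg r = ⊥ ↔ r = 0 := by
  refine ⟨fun h => ?_, fun h => h ▸ H.deg_zero⟩
  obtain ⟨f, rfl⟩ := (H.repr_unique r).exists
  rw [deg_sum, Finset.max_eq_bot, Finsupp.support_eq_empty] at h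
  simp [h]

theorem exists_deg_eq (H : IsOreExtension σ δ R C X) {r : R} (hr : r ≠ 0) :
    ∃ n : ℕ, H.deg r = n := by
  obtain ⟨n, hn⟩ := WithBot.ne_bot_iff_exists.1 (mt H.deg_eq_bot.1 hr)
  exact ⟨n, hn.symm⟩

theorem deg_mul (H : IsOreExtension σ δ R C X) (p q : R) :
    H.deg (p * q) = H.deg p + H.deg q := by
  by_cases hp : p = 0
  · simp [hp, deg_zero]
  by_cases hq : q = 0
  · simp [hq, deg_zero]
  obtain ⟨m, hm⟩ := H.exists_deg_eq hp
  obtain ⟨n, hn⟩ := H.exists_deg_eq hq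
  obtain ⟨a, ha, hpa⟩ := H.exists_leading hm
  obtain ⟨b, hb, hqb⟩ := H.exists_leading hn
  obtain ⟨c, hc, hbc⟩ := H.X_pow_mul_monomial m n hb
  rw [hm, hn]
  refine H.deg_eq_of_leading (n := m + n) (mul_ne_zero ha hc) ?_
  have hq1 : q ∈ H.degLT (n + 1) := by
    rw [mem_degLT, hn]
    exact_mod_cast n.lt_succ_self
  have e : p * q - C (a * c) * X ^ (m + n) = (p - C a * X ^ m) * q
      + (C a * (X ^ m * (q - C b * X ^ n))
        + C a * (X ^ m * (C b * X ^ n) - C c * X ^ (m + n))) := by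
    rw [map_mul]
    noncomm_ring
  rw [e]
  exact add_mem (H.mul_mem_degLT hpa hq1) (add_mem
    (H.C_mul_mem_degLT _ (H.X_pow_mul_mem_degLT m hqb)) (H.C_mul_mem_degLT _ hbc))

theorem noZeroDivisors (H : IsOreExtension σ δ R C X) : NoZeroDivisors R where
  eq_zero_or_eq_zero_of_mul_eq_zero {a b} h := by
    rwa [← H.deg_eq_bot, H.deg_mul, WithBot.add_eq_bot, H.deg_eq_bot, H.deg_eq_bot] at h

theorem deg_C (H : IsOreExtension σ δ R C X) {a : L} (ha : a ≠ 0) : H.deg (C a) = 0 := by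
  simpa using H.deg_monomial ha 0

theorem deg_one (H : IsOreExtension σ δ R C X) : H.deg 1 = 0 := by
  simpa using H.deg_C one_ne_zero

theorem deg_X_sub_C (H : IsOreExtension σ δ R C X) (a : L) : H.deg (X - C a) = 1 := by
  refine H.deg_eq_of_leading (n := 1) one_ne_zero ?_
  simpa using neg_mem (H.monomial_mem_degLT a zero_lt_one)

theorem exists_C_of_deg_eq_zero (H : IsOreExtension σ δ R C X) {r : R} (hr : H.deg r = 0) :
    ∃ c : L, c ≠ 0 ∧ r = C c := by
  obtain ⟨c, hc, h⟩ := H.exists_leading (n := 0) hr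
  refine ⟨c, hc, ?_⟩
  rw [mem_degLT] at h
  have := H.deg_eq_bot.1 (Nat.WithBot.lt_zero_iff.1 h)
  simpa [sub_eq_zero] using this

theorem zero_le_deg (H : IsOreExtension σ δ R C X) {r : R} (hr : r ≠ 0) : 0 ≤ H.deg r := by
  obtain ⟨n, hn⟩ := H.exists_deg_eq hr
  rw [hn]
  exact_mod_cast n.zero_le

theorem deg_le_of_rDvd (H : IsOreExtension σ δ R C X) {p q : R} (h : RDvd p q) (hq : q ≠ 0) :
    H.deg p ≤ H.deg q := by
  obtain ⟨u, rfl⟩ := h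
  rw [H.deg_mul]
  exact le_add_of_nonneg_left (H.zero_le_deg (left_ne_zero_of_mul hq))

theorem rDvd_of_deg_le (H : IsOreExtension σ δ R C X) {p q : R} (h : RDvd p q) (hq : q ≠ 0)
    (hd : H.deg q ≤ H.deg p) : RDvd q p := by
  obtain ⟨u, rfl⟩ := h
  have hu : u ≠ 0 := left_ne_zero_of_mul hq
  have hp : p ≠ 0 := right_ne_zero_of_mul hq
  obtain ⟨m, hm⟩ := H.exists_deg_eq hu
  obtain ⟨n, hn⟩ := H.exists_deg_eq hp
  rw [H.deg_mul, hm, hn] at hd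
  have hm0 : m = 0 := by
    have : m + n ≤ n := by exact_mod_cast hd
    omega
  subst hm0
  obtain ⟨c, hc, rfl⟩ := H.exists_C_of_deg_eq_zero hm
  exact ⟨C c⁻¹, by rw [← mul_assoc, ← map_mul, inv_mul_cancel₀ hc, map_one, one_mul]⟩

/-- Right division by a linear polynomial. -/
theorem exists_eq_mul_X_sub_C_add_C (H : IsOreExtension σ δ R C X) (a : L) (r : R) :
    ∃ (q : R) (c : L), r = q * (X - C a) + C c := by
  have key : ∀ n : ℕ, ∃ (q : R) (c : L), X ^ n = q * (X - C a) + C c := by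
    intro n
    induction n with
    | zero => exact ⟨0, 1, by simp⟩
    | succ n ih =>
      obtain ⟨q, c, h⟩ := ih
      refine ⟨X * q + C (σ c), σ c * a + δ c, ?_⟩
      rw [pow_succ', h, mul_add, H.twist, map_add, map_mul]
      noncomm_ring
  obtain ⟨f, rfl⟩ := (H.repr_unique r).exists
  choose q c h using key
  refine ⟨f.sum fun n b => C b * q n, f.sum fun n b => b * c n, ?_⟩
  simp only [Finsupp.sum, Finset.sum_mul, map_sum, ← Finset.sum_add_distrib]
  refine Finset.sum_congr rfl fun n _ => ?_
  rw [h n, map_mul]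
  noncomm_ring

theorem eq_zero_of_C_eq_mul (H : IsOreExtension σ δ R C X) {a c : L} {b : R}
    (h : C c = b * (X - C a)) : c = 0 := by
  by_contra hc
  have hd := congrArg H.deg h
  rw [H.deg_C hc, H.deg_mul, H.deg_X_sub_C] at hd
  have hb : b ≠ 0 := by
    rintro rfl
    rw [H.deg_zero] at hd
    simp at hd
  obtain ⟨n, hn⟩ := H.exists_deg_eq hb
  rw [hn] at hd
  have : 0 = n + 1 := by exact_mod_cast hd
  omega

/-- Existence of a least common left multiple with a linear polynomial. -/
theorem exists_lclm_X_sub_C (H : IsOreExtension σ δ R C X) {f : R} (hf : f ≠ 0) (a : L) :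
    ∃ m : R, m ≠ 0 ∧ RDvd f m ∧ RDvd (X - C a) m ∧
      (∀ m', RDvd f m' → RDvd (X - C a) m' → RDvd m m') ∧ H.deg m ≤ H.deg f + 1 := by
  obtain ⟨q, c, hq⟩ := H.exists_eq_mul_X_sub_C_add_C a f
  by_cases hc : c = 0
  · subst hc
    refine ⟨f, hf, ⟨1, (one_mul f).symm⟩, ⟨q, by simpa using hq⟩, fun m' h _ => h, ?_⟩
    exact le_add_of_nonneg_right zero_le_one
  have hb : ∃ b : L, b * c = σ c * a + δ c := ⟨(σ c * a + δ c) / c, div_mul_cancel₀ _ hc⟩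
  obtain ⟨b, hb⟩ := hb
  have hbc : (X - C b) * C c = C (σ c) * (X - C a) := by
    rw [sub_mul, H.twist, ← map_mul, hb, map_add, map_mul]
    noncomm_ring
  have hdeg : H.deg ((X - C b) * f) = H.deg f + 1 := by
    rw [H.deg_mul, H.deg_X_sub_C, add_comm]
  refine ⟨(X - C b) * f, ?_, ⟨_, rfl⟩, ⟨(X - C b) * q + C (σ c), ?_⟩, ?_, hdeg.le⟩
  · rw [Ne, ← H.deg_eq_bot, hdeg, WithBot.add_eq_bot, H.deg_eq_bot]
    simp [hf]
  · conv_lhs => rw [hq]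
    rw [mul_add, hbc, add_mul, mul_assoc]
  · rintro m' ⟨s, rfl⟩ ⟨t, ht⟩
    obtain ⟨s', d, rfl⟩ := H.exists_eq_mul_X_sub_C_add_C b s
    have hdc : C (d * c) = (t - (s' * (X - C b) + C d) * q - s' * C (σ c)) * (X - C a) := by
      have e : (s' * (X - C b) + C d) * f = (s' * (X - C b) + C d) * q * (X - C a)
          + s' * C (σ c) * (X - C a) + C (d * c) := by
        conv_lhs => rw [hq]
        rw [mul_add, add_mul (s' * (X - C b)) (C d) (C c), mul_assoc s' (X - C b) (C c), hbc,
          map_mul]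
        noncomm_ring
      rw [sub_mul, sub_mul, ← ht, e]
      abel
    have hd : d = 0 := (mul_eq_zero.1 (H.eq_zero_of_C_eq_mul hdc)).resolve_right hc
    exact ⟨s', by rw [hd, map_zero, add_zero, mul_assoc]⟩

end IsOreExtension

theorem RDvd.trans {R : Type*} [Ring R] {a b c : R} (h : RDvd a b) (h' : RDvd b c) :
    RDvd a c := by
  obtain ⟨u, rfl⟩ := h
  obtain ⟨w, rfl⟩ := h'
  exact ⟨w * u, (mul_assoc _ _ _).symm⟩

theorem RDvd.refl {R : Type*} [Ring R] (a : R) : RDvd a a := ⟨1, (one_mul a).symm⟩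

theorem RDvd.one_left {R : Type*} [Ring R] (a : R) : RDvd 1 a := ⟨a, (mul_one a).symm⟩

namespace IsOreExtension

variable {L : Type*} [Field L] {σ : L ≃+* L} {δ : L → L}
  {R : Type*} [Ring R] {C : L →+* R} {X : R}

theorem exists_lclm_finset (H : IsOreExtension σ δ R C X) {ι : Type*} (α : ι → L) {v : R}
    (hv : v ≠ 0) (T : Finset ι) :
    ∃ m : R, m ≠ 0 ∧ RDvd v m ∧ (∀ i ∈ T, RDvd (X - C (α i)) m) ∧
      (∀ m', RDvd v m' → (∀ i ∈ T, RDvd (X - C (α i)) m') → RDvd m m') ∧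
      H.deg m ≤ H.deg v + (T.card : WithBot ℕ) := by
  classical
  induction T using Finset.induction_on with
  | empty => exact ⟨v, hv, .refl v, by simp, fun m' h _ => h, by simp⟩
  | insert i T hi ih =>
    obtain ⟨m, hm, hvm, hTm, hmin, hdeg⟩ := ih
    obtain ⟨M, hM, hmM, hiM, hMmin, hMdeg⟩ := H.exists_lclm_X_sub_C hm (α i)
    refine ⟨M, hM, hvm.trans hmM, ?_, fun m' hvm' h => ?_, ?_⟩
    · simpa using ⟨hiM, fun j hj => (hTm j hj).trans hmM⟩
    · exact hMmin m' (hmin m' hvm' fun j hj => h j (Finset.mem_insert_of_mem hj))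
        (h i (Finset.mem_insert_self i T))
    · rw [Finset.card_insert_of_notMem hi, Nat.cast_add, Nat.cast_one, ← add_assoc]
      exact hMdeg.trans (by gcongr)

/-- Under P-independence, a common left multiple of the linear polynomials indexed by `T`
has degree at least the cardinality of `T`. -/
theorem card_le_deg (H : IsOreExtension σ δ R C X) {n : ℕ} {α : Fin n → L} {Λ : R}
    (hΛ : IsLclm (fun i => X - C (α i)) Λ) (hΛd : H.deg Λ = n) {m : R} (hm : m ≠ 0)
    {T : Finset (Fin n)} (hT : ∀ i ∈ T, RDvd (X - C (α i)) m) :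
    (T.card : WithBot ℕ) ≤ H.deg m := by
  obtain ⟨M, hM, hmM, hTM, -, hMd⟩ := H.exists_lclm_finset α hm Tᶜ
  have hΛM : RDvd Λ M := by
    refine hΛ.2 M fun i => ?_
    by_cases hi : i ∈ T
    · exact (hT i hi).trans hmM
    · exact hTM i (by simpa using hi)
  have h := (H.deg_le_of_rDvd hΛM hM).trans hMd
  obtain ⟨d, hd⟩ := H.exists_deg_eq hm
  rw [hΛd, hd] at h
  rw [hd]
  have h' : n ≤ d + Tᶜ.card := by exact_mod_cast h
  have hc := T.card_compl_add_card
  rw [Fintype.card_fin] at hc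
  exact_mod_cast (by omega : T.card ≤ d)

theorem mem_of_rDvd (H : IsOreExtension σ δ R C X) {n : ℕ} {α : Fin n → L} {Λ : R}
    (hΛ : IsLclm (fun i => X - C (α i)) Λ) (hΛd : H.deg Λ = n) {m : R} (hm : m ≠ 0)
    {T : Finset (Fin n)} (hT : ∀ i ∈ T, RDvd (X - C (α i)) m)
    (hmT : H.deg m ≤ T.card) {i : Fin n} (hi : RDvd (X - C (α i)) m) : i ∈ T := by
  by_contra hiT
  have h := (H.card_le_deg hΛ hΛd hm (T := insert i T) (by simpa using ⟨hi, hT⟩)).trans hmT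
  rw [Finset.card_insert_of_notMem hiT] at h
  have : T.card + 1 ≤ T.card := by exact_mod_cast h
  omega

/-- Under P-independence, a common left multiple of minimal possible degree of the linear
polynomials indexed by `T` is a least common left multiple. -/
theorem rDvd_of_deg_le_card (H : IsOreExtension σ δ R C X) {n : ℕ} {α : Fin n → L} {Λ : R}
    (hΛ : IsLclm (fun i => X - C (α i)) Λ) (hΛd : H.deg Λ = n) {v : R} (hv : v ≠ 0)
    {T : Finset (Fin n)} (hT : ∀ i ∈ T, RDvd (X - C (α i)) v) (hvT : H.deg v ≤ T.card)
    {m : R} (hm : ∀ i ∈ T, RDvd (X - C (α i)) m) : RDvd v m := by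
  have h1 : (1 : R) ≠ 0 := by
    rw [Ne, ← H.deg_eq_bot, H.deg_one]
    simp
  obtain ⟨w, hw, -, hTw, hmin, -⟩ := H.exists_lclm_finset α h1 T
  exact (H.rDvd_of_deg_le (hmin v (.one_left v) hT) hv
    (hvT.trans (H.card_le_deg hΛ hΛd hw hTw))).trans (hmin m (.one_left m) hm)

end IsOreExtension

/-- If `lam` is the least common left multiple of P-independent linear polynomials, with
cofactors `ρ j`, and `∑ j, ρ j * C (b j)` (all `b j ≠ 0`) lies in the right ideal `h R`, where
`lam = h * v` and `v` right-divides every common left multiple of its positional roots, then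
every root of `lam` is a root of `v`. -/
theorem IsOreExtension.rDvd_of_eq_mul {L : Type*} [Field L] {σ : L ≃+* L} {δ : L → L}
    {R : Type*} [Ring R] {C : L →+* R} {X : R} (H : IsOreExtension σ δ R C X)
    {n : ℕ} {α : Fin n → L} {Λ : R}
    (hΛ : IsLclm (fun i => X - C (α i)) Λ) (hΛd : H.deg Λ = n)
    {ν : ℕ} {k : Fin ν → Fin n} (hk : Function.Injective k) {lam : R} (hlam0 : lam ≠ 0)
    {ρ : Fin ν → R} (hρ : ∀ j, lam = ρ j * (X - C (α (k j))))
    {b : Fin ν → L} (hb : ∀ j, b j ≠ 0) {h v r : R} (hhv : h * v = lam)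
    (hhr : h * r = ∑ j, ρ j * C (b j)) {S : Finset (Fin n)}
    (hSk : ∀ i ∈ S, ∃ j, k j = i)
    (hSv : ∀ m, (∀ i ∈ S, RDvd (X - C (α i)) m) → RDvd v m) (j : Fin ν) : k j ∈ S := by
  classical
  have := H.noZeroDivisors
  by_contra hj
  have h1 : (1 : R) ≠ 0 := by
    rw [Ne, ← H.deg_eq_bot, H.deg_one]
    simp
  set T : Finset (Fin n) := (Finset.univ.erase j).image k with hTdef
  have hkT : ∀ i, i ≠ j → k i ∈ T := fun i hi =>
    Finset.mem_image_of_mem k (by simpa using hi)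
  obtain ⟨m, hm, -, hTm, hmin, hdeg⟩ := H.exists_lclm_finset α h1 T
  rw [H.deg_one, zero_add] at hdeg
  have hjm : ¬ RDvd (X - C (α (k j))) m := fun hd => by
    have := H.mem_of_rDvd hΛ hΛd hm hTm hdeg hd
    rw [hTdef, Finset.mem_image] at this
    obtain ⟨i, hi, hij⟩ := this
    exact (Finset.mem_erase.1 hi).1 (hk hij)
  obtain ⟨d, hd⟩ : RDvd m lam := by
    refine hmin lam (.one_left _) fun i hi => ?_
    obtain ⟨i', -, rfl⟩ := Finset.mem_image.1 hi
    exact ⟨_, hρ i'⟩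
  have hd0 : d ≠ 0 := left_ne_zero_of_mul (hd ▸ hlam0)
  have hv0 : v ≠ 0 := right_ne_zero_of_mul (hhv ▸ hlam0)
  have hX (i : Fin n) : X - C (α i) ≠ 0 := by
    rw [Ne, ← H.deg_eq_bot, H.deg_X_sub_C]
    simp
  obtain ⟨w, hw⟩ : RDvd v m := by
    refine hSv m fun i hi => ?_
    obtain ⟨i', rfl⟩ := hSk i hi
    exact hTm _ (hkT i' fun e => hj (e ▸ hi))
  have hh : h = d * w := by
    apply mul_right_cancel₀ hv0
    rw [hhv, hd, hw, mul_assoc]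
  have hcof : ∀ i, i ≠ j → ∃ t, ρ i = d * t := by
    intro i hi
    obtain ⟨t, ht⟩ := hTm _ (hkT i hi)
    refine ⟨t, mul_right_cancel₀ (hX (k i)) ?_⟩
    rw [← hρ i, hd, ht, mul_assoc]
  have hsum : ∃ t, ∑ i ∈ Finset.univ.erase j, ρ i * C (b i) = d * t := by
    have : ∀ i, ∃ t, i ≠ j → ρ i = d * t := fun i => by
      by_cases hi : i = j
      · exact ⟨0, fun h => absurd hi h⟩
      · obtain ⟨t, ht⟩ := hcof i hi
        exact ⟨t, fun _ => ht⟩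
    choose t ht using this
    refine ⟨∑ i ∈ Finset.univ.erase j, t i * C (b i), ?_⟩
    rw [Finset.mul_sum]
    refine Finset.sum_congr rfl fun i hi => ?_
    rw [ht i (Finset.mem_erase.1 hi).1, mul_assoc]
  obtain ⟨t, ht⟩ := hsum
  rw [← Finset.add_sum_erase _ _ (Finset.mem_univ j), ht, hh] at hhr
  have hρj : ρ j = d * ((w * r - t) * C (b j)⁻¹) := by
    have e : ρ j * C (b j) = d * (w * r - t) := by
      rw [mul_sub, ← mul_assoc, hhr, add_sub_cancel_right]
    rw [← mul_assoc, ← e, mul_assoc, ← map_mul, mul_inv_cancel₀ (hb j), map_one, mul_one]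
  refine hjm ⟨(w * r - t) * C (b j)⁻¹, mul_left_cancel₀ hd0 ?_⟩
  rw [← hd, ← mul_assoc, ← hρj, ← hρ j]

/-- Proposition 13 of the paper (finding a new right root of the locator): assume
`lam = h * v` with `deg h ≥ 1`, and let `l 0, …, l (rr-1)` enumerate the positional
indices `i` such that `x - α i` does not right-divide `v`.  Form the sequence
`f 0 = v`, `f (i+1) = lclm (f i, x - α (l i))`.  Then some step does not increase
the degree, and at the first such step `d₀` the polynomial `x - α (l d₀)`
right-divides `lam`, i.e. `l d₀` is an error position. -/
theorem finding_new_root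
    {L : Type*} [Field L] (σ : L ≃+* L) (δ : L → L) (hδ : IsSigmaDerivation σ δ)
    {R : Type*} [Ring R] (C : L →+* R) (X : R) (H : IsOreExtension σ δ R C X)
    (F : Subfield L) (n : ℕ) (α : Fin n → L) (hα : Function.Injective α)
    (g : R) (hg0 : g ≠ 0)
    (hginv : ∀ a : R, ∃ b : R, a * g = g * b) (hginv' : ∀ a : R, ∃ b : R, g * a = b * g)
    (hcop : ∀ i, RCoprime (X - C (α i)) g)
    (hp : Fin n → R) (hpdeg : ∀ i, H.deg (hp i) < H.deg g)
    (hpinv : ∀ i, ∃ w : R, (X - C (α i)) * hp i - 1 = w * g)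
    (η : Fin n → L) (hη : ∀ i, η i ≠ 0)
    (c e y : Fin n → L) (hcF : ∀ i, c i ∈ F) (heF : ∀ i, e i ∈ F)
    (hcode : ∑ i, hp i * C (η i) * C (c i) = 0)
    (ν : ℕ) (k : Fin ν → Fin n) (hk : Function.Injective k)
    (hek : ∀ j, e (k j) ≠ 0) (hesupp : ∀ i, (∀ j, k j ≠ i) → e i = 0)
    (hy : y = c + e)
    (s : R) (hs : s = ∑ i, hp i * C (η i) * C (y i))
    (lam : R) (hlam : IsLclm (fun j : Fin ν => X - C (α (k j))) lam)
    (ρ : Fin ν → R) (hρ : ∀ j, lam = ρ j * (X - C (α (k j))))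
    (ω : R) (hω : ω = ∑ j, ρ j * C (η (k j)) * C (e (k j)))
    (χ : ℕ) (hχ : H.deg g = (χ : WithBot ℕ)) (hν : ν ≤ χ / 2)
    (Pind : ∃ Λ : R, IsLclm (fun i : Fin n => X - C (α i)) Λ ∧ H.deg Λ = (n : WithBot ℕ))
    (κ : R) (hκ : ω = κ * g + lam * s)
    (u v r h : R) (huvr : u * g + v * s = r)
    (hhu : h * u = κ) (hhv : h * v = lam) (hhr : h * r = ω)
    (hdegh : (1 : WithBot ℕ) ≤ H.deg h)
    (rr : ℕ) (l : ℕ → Fin n)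
    (hlinj : ∀ i j : ℕ, i < rr → j < rr → l i = l j → i = j)
    (hlrange : ∀ idx : Fin n, (∃ i : ℕ, i < rr ∧ l i = idx) ↔ ¬ RDvd (X - C (α idx)) v)
    (f : ℕ → R) (hf0 : f 0 = v)
    (hfstep : ∀ i : ℕ, i < rr → IsLclm ![f i, X - C (α (l i))] (f (i + 1))) :
    (∃ d : ℕ, d < rr ∧ H.deg (f d) = H.deg (f (d + 1))) ∧
    (∀ d₀ : ℕ, d₀ < rr → H.deg (f d₀) = H.deg (f (d₀ + 1)) →
      (∀ d : ℕ, d < d₀ → H.deg (f d) ≠ H.deg (f (d + 1))) →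
      RDvd (X - C (α (l d₀))) lam ∧ ∃ j, k j = l d₀) := by
  classical
  obtain ⟨Λ, hΛ, hΛd⟩ := Pind
  have hΛ0 : Λ ≠ 0 := by
    rw [Ne, ← H.deg_eq_bot, hΛd]
    simp
  have h1 : (1 : R) ≠ 0 := by
    rw [Ne, ← H.deg_eq_bot, H.deg_one]
    simp
  have ne_zero_of_rDvd {a b : R} (hab : RDvd a b) (hb : b ≠ 0) : a ≠ 0 := by
    obtain ⟨t, rfl⟩ := hab
    exact right_ne_zero_of_mul hb
  have hlamΛ : RDvd lam Λ := hlam.2 Λ fun j => hΛ.1 (k j)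
  have hlam0 : lam ≠ 0 := ne_zero_of_rDvd hlamΛ hΛ0
  have hvlam : RDvd v lam := ⟨h, hhv.symm⟩
  have hv0 : v ≠ 0 := ne_zero_of_rDvd hvlam hlam0
  have hfM : ∀ (M : R) (d : ℕ), d ≤ rr → RDvd lam M →
      (∀ i < d, RDvd (X - C (α (l i))) M) → RDvd (f d) M := by
    intro M d
    induction d with
    | zero => exact fun _ hM _ => hf0 ▸ hvlam.trans hM
    | succ d ih =>
      intro hd hM hl
      refine (hfstep d hd).2 M fun i => ?_
      fin_cases i
      · exact ih (by omega) hM fun i hi => hl i (by omega)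
      · exact hl d d.lt_succ_self
  have hfΛ : ∀ d ≤ rr, RDvd (f d) Λ := fun d hd => hfM Λ d hd hlamΛ fun i _ => hΛ.1 (l i)
  have hfstep_left : ∀ d < rr, RDvd (f d) (f (d + 1)) := fun d hd => (hfstep d hd).1 0
  have hfstep_right : ∀ d < rr, RDvd (X - C (α (l d))) (f (d + 1)) :=
    fun d hd => (hfstep d hd).1 1
  have hmul : ∀ T : Finset (Fin n), ∃ m : R, m ≠ 0 ∧ (∀ i ∈ T, RDvd (X - C (α i)) m) ∧
      ∀ i, RDvd (X - C (α i)) m → i ∈ T := by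
    intro T
    obtain ⟨m, hm, -, hTm, -, hdeg⟩ := H.exists_lclm_finset α h1 T
    rw [H.deg_one, zero_add] at hdeg
    exact ⟨m, hm, hTm, fun i hi => H.mem_of_rDvd hΛ hΛd hm hTm hdeg hi⟩
  constructor
  · by_contra! hne
    have hgrow : ∀ d ≤ rr, H.deg v + (d : WithBot ℕ) ≤ H.deg (f d) := by
      intro d
      induction d with
      | zero => simp [hf0]
      | succ d ih =>
        intro hd
        have hf1 : f (d + 1) ≠ 0 := ne_zero_of_rDvd (hfΛ _ hd) hΛ0
        have hlt := lt_of_le_of_ne (H.deg_le_of_rDvd (hfstep_left d hd) hf1) (hne d hd)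
        have hle := (ih (by omega)).trans_lt hlt
        obtain ⟨a, ha⟩ := H.exists_deg_eq hv0
        obtain ⟨b, hb⟩ := H.exists_deg_eq hf1
        rw [ha, hb] at hle ⊢
        have : a + d < b := by exact_mod_cast hle
        exact_mod_cast (by omega : a + (d + 1) ≤ b)
    have hle := (hgrow rr le_rfl).trans (H.deg_le_of_rDvd (hfΛ rr le_rfl) hΛ0)
    set S : Finset (Fin n) := Finset.univ.filter fun i => RDvd (X - C (α i)) v with hS
    have hSv : ∀ i ∈ S, RDvd (X - C (α i)) v := fun i hi => (Finset.mem_filter.1 hi).2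
    have hSc : Sᶜ.card = rr := by
      have : Sᶜ = (Finset.range rr).image l := by
        ext i
        simp [hS, ← hlrange]
      rw [this, Finset.card_image_of_injOn, Finset.card_range]
      intro i hi j hj hij
      exact hlinj i j (by simpa using hi) (by simpa using hj) hij
    have hvS : H.deg v ≤ S.card := by
      obtain ⟨a, ha⟩ := H.exists_deg_eq hv0
      rw [ha, hΛd] at hle
      rw [ha]
      have h2 : a + rr ≤ n := by exact_mod_cast hle
      have h3 := S.card_compl_add_card
      rw [Fintype.card_fin] at h3
      exact_mod_cast (by omega : a ≤ S.card)
    have hSk : ∀ i ∈ S, ∃ j, k j = i := by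
      intro i hi
      obtain ⟨m, -, hTm, hmem⟩ := hmul (Finset.univ.image k)
      have hlm : RDvd lam m := hlam.2 m fun j => hTm _ (by simp)
      simpa using hmem i (((hSv i hi).trans hvlam).trans hlm)
    have hhr' : h * r = ∑ j, ρ j * C (η (k j) * e (k j)) := by
      rw [hhr, hω]
      exact Finset.sum_congr rfl fun j _ => by rw [map_mul, mul_assoc]
    have hkS := H.rDvd_of_eq_mul hΛ hΛd hk hlam0 hρ
      (fun j => mul_ne_zero (hη (k j)) (hek j)) hhv hhr' hSk
      (fun m hm => H.rDvd_of_deg_le_card hΛ hΛd hv0 hSv hvS hm)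
    have hlv := H.deg_le_of_rDvd (hlam.2 v fun j => hSv _ (hkS j)) hv0
    obtain ⟨a, ha⟩ := H.exists_deg_eq hv0
    obtain ⟨b, hb⟩ := H.exists_deg_eq (left_ne_zero_of_mul (hhv ▸ hlam0) : h ≠ 0)
    rw [← hhv, H.deg_mul, ha, hb] at hlv
    rw [hb] at hdegh
    have h2 : b + a ≤ a := by exact_mod_cast hlv
    have h3 : 1 ≤ b := by exact_mod_cast hdegh
    omega
  · intro d hd heq _
    have hf1 : f (d + 1) ≠ 0 := ne_zero_of_rDvd (hfΛ _ hd) hΛ0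
    have hld : RDvd (X - C (α (l d))) (f d) :=
      (hfstep_right d hd).trans (H.rDvd_of_deg_le (hfstep_left d hd) hf1 heq.ge)
    obtain ⟨m, -, hTm, hmem⟩ := hmul (Finset.univ.image k ∪ (Finset.range d).image l)
    have hfm : RDvd (f d) m := by
      refine hfM m d hd.le (hlam.2 m fun j => hTm _ (by simp)) fun i hi => hTm _ ?_
      exact Finset.mem_union_right _ (Finset.mem_image_of_mem l (by simpa using hi))
    have hj : ∃ j, k j = l d := by
      rcases Finset.mem_union.1 (hmem _ (hld.trans hfm)) with hj | hj
      · simpa using hj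
      · obtain ⟨i, hi, hil⟩ := Finset.mem_image.1 hj
        have hi' := Finset.mem_range.1 hi
        have := hlinj i d (by omega) hd hil
        omega
    obtain ⟨j, hj⟩ := hj
    exact ⟨hj ▸ hlam.1 j, j, hj⟩
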